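/- The map φ(z) := (1 − e^{−z})/(1 + e^{−z}) is a holomorphic bijection from the half-strip {z ∈ ℂ : Re z > 0, |Im z| < π} onto the slit half-plane {s ∈ ℂ : Re s > 0, s ∉ [1, ∞)}. -/

import Mathlib

theorem aux_w (z : ℂ) (h : 0 < z.re ∧ |z.im| < Real.pi) :
    Complex.normSq (Complex.exp (-z)) < 1 ∧ Complex.exp (-z) ∈ Complex.slitPlane ∧
      1 + Complex.exp (-z) ≠ 0 ∧ Complex.log (Complex.exp (-z)) = -z := by
  obtain ⟨h1, h2⟩ := h
  rw [abs_lt] at h2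
  have hl : Complex.log (Complex.exp (-z)) = -z := by
    apply Complex.log_exp <;> simp <;> linarith
  have hn : ‖Complex.exp (-z)‖ < 1 := by
    rw [Complex.norm_exp]; simpa using h1
  refine ⟨?_, ?_, ?_, hl⟩
  · rw [Complex.normSq_eq_norm_sq]
    nlinarith [norm_nonneg (Complex.exp (-z))]
  · rw [Complex.mem_slitPlane_iff_arg]
    refine ⟨?_, Complex.exp_ne_zero _⟩
    rw [← Complex.log_im, hl]
    simp only [Complex.neg_im]
    intro h; linarith
  · intro h
    have : Complex.exp (-z) = -1 := by linear_combination h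
    rw [this] at hn
    simp at hn

/-- The map `z ↦ (1-e^(-z))/(1+e^(-z))` is a holomorphic bijection from the
half-strip `{Re z > 0, |Im z| < π}` onto the slit half-plane
`{Re s > 0} \ [1,∞)`. -/
theorem biholomorphic_halfstrip_onto_slit_halfplane :
    DifferentiableOn ℂ (fun z => (1 - Complex.exp (-z)) / (1 + Complex.exp (-z)))
        {z : ℂ | 0 < z.re ∧ |z.im| < Real.pi} ∧
      Set.BijOn (fun z => (1 - Complex.exp (-z)) / (1 + Complex.exp (-z)))
        {z : ℂ | 0 < z.re ∧ |z.im| < Real.pi}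
        {s : ℂ | 0 < s.re ∧ s ∉ Complex.ofReal '' Set.Ici (1 : ℝ)} := by
  refine ⟨?_, ?_, ?_, ?_⟩
  · intro z hz
    obtain ⟨-, -, h, -⟩ := aux_w z hz
    apply DifferentiableAt.differentiableWithinAt
    have : DifferentiableAt ℂ (fun z : ℂ => Complex.exp (-z)) z := by fun_prop
    exact ((differentiableAt_const _).sub this).div ((differentiableAt_const _).add this) h
  · intro z hz
    obtain ⟨hn, hs, h, -⟩ := aux_w z hz
    simp only [Set.mem_setOf_eq]
    generalize Complex.exp (-z) = w at *
    refine ⟨?_, ?_⟩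
    · have hN := Complex.normSq_pos.2 h
      rw [Complex.div_re, ← add_div]
      apply div_pos _ hN
      rw [Complex.normSq_apply] at hn
      simp
      nlinarith
    · rintro ⟨r, hr, he⟩
      rw [Set.mem_Ici] at hr
      rw [eq_div_iff h] at he
      have e1 := congrArg Complex.re he
      have e2 := congrArg Complex.im he
      simp at e1 e2
      have him : w.im = 0 := by
        have : (r + 1) * w.im = 0 := by linarith
        rcases mul_eq_zero.1 this with h | h
        · linarith
        · exact h
      rcases hs with hs | hs
      · nlinarith
      · exact hs him
  · intro z hz z' hz' he
    obtain ⟨-, -, h, hl⟩ := aux_w z hz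
    obtain ⟨-, -, h', hl'⟩ := aux_w z' hz'
    simp only at he
    rw [div_eq_div_iff h h'] at he
    have : Complex.exp (-z) = Complex.exp (-z') := by linear_combination (-1/2) * he
    rw [this, hl'] at hl
    exact (neg_injective hl).symm
  · rintro s ⟨hs, hns⟩
    have h1 : 1 + s ≠ 0 := by
      intro h
      have := congrArg Complex.re h
      simp at this
      linarith
    obtain ⟨w, hw⟩ : ∃ w, w = (1 - s) / (1 + s) := ⟨_, rfl⟩
    have hw1 : w * (1 + s) = 1 - s := by rw [hw]; field_simp
    have hw2 : 1 + w ≠ 0 := by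
      intro h
      have : (2 : ℂ) = 0 := by linear_combination (1 + s) * h - hw1
      norm_num at this
    have hsw : s = (1 - w) / (1 + w) := by
      rw [eq_div_iff hw2]; linear_combination hw1
    have hn : ‖w‖ < 1 := by
      rw [hw, norm_div, div_lt_one (norm_pos_iff.2 h1)]
      rw [← sq_lt_sq₀ (norm_nonneg _) (norm_nonneg _), ← Complex.normSq_eq_norm_sq,
        ← Complex.normSq_eq_norm_sq, Complex.normSq_apply, Complex.normSq_apply]
      simp
      nlinarith
    have hsl : w ∈ Complex.slitPlane := by
      by_contra hc
      rw [Complex.mem_slitPlane_iff] at hc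
      push Not at hc
      obtain ⟨hre, him⟩ := hc
      apply hns
      have hwr : w = (w.re : ℂ) := by apply Complex.ext <;> simp [him]
      have hb := (abs_lt.1 (lt_of_le_of_lt (Complex.abs_re_le_norm w) hn)).1
      refine ⟨(1 - w.re) / (1 + w.re), ?_, ?_⟩
      · rw [Set.mem_Ici, le_div_iff₀ (by linarith)]; linarith
      · rw [hsw]; push_cast; rw [← hwr]
    have hw0 := Complex.slitPlane_ne_zero hsl
    refine ⟨-Complex.log w, ⟨?_, ?_⟩, ?_⟩
    · rw [Complex.neg_re, Complex.log_re]
      linarith [Real.log_neg (norm_pos_iff.2 hw0) hn]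
    · rw [Complex.neg_im, Complex.log_im, abs_neg]
      exact lt_of_le_of_ne (Complex.abs_arg_le_pi w) (by
        have h3 := (Complex.mem_slitPlane_iff_arg.1 hsl).1
        have h4 := Complex.neg_pi_lt_arg w
        intro h
        rcases abs_eq Real.pi_pos.le |>.1 h with h | h
        · exact h3 h
        · linarith)
    · simp only [neg_neg]
      rw [Complex.exp_log hw0, ← hsw]
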